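/- Let n, r, s be nonnegative integers, let a, b, c, d, p, x ∈ ℂ and a₁,…,a_r, b₁,…,b_s ∈ ℂ. Set λ = 2a−b−c−d, assume bcd + p(a−p)(a−b−c−d) ≠ 0, and let γ ∈ ℂ satisfy γ² = λ²/4 − p(a−p)(a−b−c)(a−b−d)(a−c−d)/(bcd + p(a−p)(a−b−c−d)). Assume the parameters are nondegenerate for the identity below. Then ᵣ₊₇Fₛ₊₅(a, b, c, d, a−p+1, p+1, a₁,…,a_r, −n; 1+a−b, 1+a−c, 1+a−d, p, a−p, b₁,…,b_s; x) equals Σ_{m=0}^{n} [ (λ)_m (λ+b−a)_m (λ+c−a)_m (λ+d−a)_m (a/2)_m ((a+1)/2)_m (λ/2−γ+1)_m (λ/2+γ+1)_m (a₁)_m⋯(a_r)_m (−n)_m x^m / ( m! (λ/2)_m ((λ+1)/2)_m (1+a−b)_m (1+a−c)_m (1+a−d)_m (λ/2+γ)_m (λ/2−γ)_m (b₁)_m⋯(b_s)_m ) ] · ᵣ₊₃Fₛ₊₁(a+2m, a−λ, a₁+m, …, a_r+m, −(n−m); 1+λ+2m, b₁+m, …, b_s+m; x). -/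

import Mathlib

/-- Rising factorial (Pochhammer symbol) `(a)ₖ = a(a+1)⋯(a+k−1)`. -/
noncomputable def poch (a : ℂ) (k : ℕ) : ℂ := (ascPochhammer ℂ k).eval a

/-- Terminating hypergeometric sum with numerator parameters `A` together with
the extra top parameter `-n`, denominator parameters `B`, and argument `x`. -/
noncomputable def hypTerm (A B : List ℂ) (n : ℕ) (x : ℂ) : ℂ :=
  ∑ k ∈ Finset.range (n + 1),
    ((A.map fun a => poch a k).prod * poch (-(n : ℂ)) k) /
      ((k.factorial : ℂ) * (B.map fun b => poch b k).prod) * x ^ k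

theorem poch_zero (z : ℂ) : poch z 0 = 1 := by simp [poch]

theorem poch_succ (z : ℂ) (k : ℕ) : poch z (k + 1) = poch z k * (z + k) := by
  simp [poch, ascPochhammer_succ_eval]

theorem poch_add (z : ℂ) (m k : ℕ) : poch z (m + k) = poch z m * poch (z + m) k := by
  induction k with
  | zero => simp [poch_zero]
  | succ k ih =>
    rw [← add_assoc, poch_succ, poch_succ, ih]
    push_cast
    ring

theorem poch_succ_left (z : ℂ) (k : ℕ) : poch z (k + 1) = z * poch (z + 1) k := by
  rw [add_comm k, poch_add, poch_succ, poch_zero]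
  simp

theorem poch_ne_zero_of_le {z : ℂ} {m k : ℕ} (h : poch z k ≠ 0) (hmk : m ≤ k) :
    poch z m ≠ 0 := by
  obtain ⟨j, rfl⟩ := Nat.exists_eq_add_of_le hmk
  rw [poch_add] at h
  exact left_ne_zero_of_mul h

theorem add_natCast_ne_zero_of_poch {z : ℂ} {m k : ℕ} (h : poch z k ≠ 0) (hmk : m < k) :
    z + m ≠ 0 := by
  have := poch_ne_zero_of_le h (Nat.succ_le_of_lt hmk)
  rw [Nat.succ_eq_add_one, poch_succ] at this
  exact right_ne_zero_of_mul this

/-- Legendre duplication for rising factorials. -/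
theorem poch_two_mul (z : ℂ) (m : ℕ) :
    poch z (2 * m) = 4 ^ m * (poch (z / 2) m * poch ((z + 1) / 2) m) := by
  induction m with
  | zero => simp [poch_zero]
  | succ m ih =>
    rw [show 2 * (m + 1) = 2 * m + 1 + 1 by ring, poch_succ, poch_succ, ih, poch_succ, poch_succ]
    push_cast
    ring

theorem poch_add_one_eq (z : ℂ) (m : ℕ) : z * poch (z + 1) m = poch z m * (z + m) := by
  rw [← poch_succ_left, poch_succ]

/-- The summand of a terminating well-poised series with parameters
`L, L+b-a, L+c-a, L+d-a, a+N, -N`, up to normalization. -/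
noncomputable def wellPoisedTerm (a b c d L : ℂ) (N m : ℕ) : ℂ :=
  poch L m * poch (L + b - a) m * poch (L + c - a) m * poch (L + d - a) m *
      poch (a + N) m * poch (a - L) (N - m) /
    (m.factorial * (N - m).factorial * poch (1 + a - b) m * poch (1 + a - c) m *
      poch (1 + a - d) m * (poch L (2 * m) * poch (1 + L + 2 * m) (N - m)))

/-- The telescoping companion of `wellPoisedTerm`, without its polynomial certificate. -/
noncomputable def wellPoisedCompanion (a b c d L : ℂ) (N m : ℕ) : ℂ :=
  poch L (m + 1) * poch (L + b - a) (m + 1) * poch (L + c - a) (m + 1) *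
      poch (L + d - a) (m + 1) * poch (a + N + 1) m * poch (a - L) (N - m) /
    (m.factorial * (N - m).factorial * poch (1 + a - b) m * poch (1 + a - c) m *
      poch (1 + a - d) m * poch L (N + m + 2))

theorem poch_mul_shift (L : ℂ) (m k : ℕ) :
    poch L (2 * m) * (L + 2 * m) * poch (1 + L + 2 * m) k = poch L (2 * m + k + 1) := by
  rw [show 2 * m + k + 1 = (2 * m + 1) + k by ring, poch_add, poch_succ]
  push_cast
  rw [show L + (2 * (m : ℂ) + 1) = 1 + L + 2 * m by ring]

/-- Away from the last index the very-well-poised factor can be made explicit. -/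
theorem wellPoisedTerm_eq (a b c d L : ℂ) (m k : ℕ) (h : L + 2 * m ≠ 0) :
    wellPoisedTerm a b c d L (m + k) m =
      poch L m * poch (L + b - a) m * poch (L + c - a) m * poch (L + d - a) m *
          poch (a + (m + k : ℕ)) m * poch (a - L) k * (L + 2 * m) /
        (m.factorial * k.factorial * poch (1 + a - b) m * poch (1 + a - c) m *
          poch (1 + a - d) m * poch L (2 * m + k + 1)) := by
  rw [wellPoisedTerm, ← poch_mul_shift, Nat.add_sub_cancel_left]
  rw [← mul_div_mul_right _ _ h]
  congr 1
  ring

theorem sum_wellPoisedTerm_step (a b c d L : ℂ) (N : ℕ) (u v : ℂ) (w R : ℕ → ℂ)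
    (hL : poch L (2 * N + 2) ≠ 0) (hb : poch (1 + a - b) (N + 1) ≠ 0)
    (hc : poch (1 + a - c) (N + 1) ≠ 0) (hd : poch (1 + a - d) (N + 1) ≠ 0)
    (h0 : w 0 * (u * (a - L + N) - v * (N + 1) * (L + N + 1)) =
      R 1 * (L + b - a) * (L + c - a) * (L + d - a) * (N + 1))
    (hi : ∀ i : ℕ, w i * (L + 2 * i) * (u * (a + N + i) * (a - L + N - i)
        - v * (a + N) * (N + 1 - i) * (L + N + 1 + i)) =
      R (i + 1) * (L + i) * (L + b - a + i) * (L + c - a + i) * (L + d - a + i) *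
          (a + N + i) * (N + 1 - i)
        - R i * i * (a - b + i) * (a - c + i) * (a - d + i) * (a - L + N - i) * (L + N + 1 + i))
    (hf : w (N + 1) * u * (a + 2 * N + 1) =
      -(R (N + 1) * (N + 1) * (1 + a - b + N) * (1 + a - c + N) * (1 + a - d + N))) :
    u * ∑ m ∈ Finset.range (N + 2), w m * wellPoisedTerm a b c d L (N + 1) m =
      v * ∑ m ∈ Finset.range (N + 1), w m * wellPoisedTerm a b c d L N m := by
  have key : ∀ M ≤ N, ∑ m ∈ Finset.range (M + 1),
      (u * (w m * wellPoisedTerm a b c d L (N + 1) m) -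
        v * (w m * wellPoisedTerm a b c d L N m)) =
      R (M + 1) * wellPoisedCompanion a b c d L N M := by
    intro M
    induction M with
    | zero =>
      intro _
      have hL0 : L ≠ 0 := by
        simpa using add_natCast_ne_zero_of_poch hL (show 0 < 2 * N + 2 by omega)
      have hLN : poch L (N + 2) ≠ 0 := poch_ne_zero_of_le hL (by omega)
      have e1 : poch L (N + 2) = L * (poch (1 + L) N * (1 + L + N)) := by
        rw [poch_succ_left, poch_succ, add_comm L 1]
      rw [e1] at hLN
      have h1 := right_ne_zero_of_mul hLN
      have h2 := left_ne_zero_of_mul h1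
      have h3 := right_ne_zero_of_mul h1
      have h4 : (N : ℂ) + 1 ≠ 0 := Nat.cast_add_one_ne_zero N
      have h5 : (N.factorial : ℂ) ≠ 0 := Nat.cast_ne_zero.2 N.factorial_ne_zero
      simp only [wellPoisedTerm, wellPoisedCompanion, Finset.sum_range_one, zero_add, mul_zero,
        Nat.sub_zero, poch_zero, Nat.cast_zero, Nat.factorial_zero, Nat.factorial_succ,
        add_zero, e1]
      simp only [poch_succ, poch_zero, Nat.cast_zero, add_zero, Nat.cast_mul, Nat.cast_add,
        Nat.cast_one]
      field_simp
      linear_combination poch (a - L) N * h0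
    | succ m ih =>
      intro hm
      rw [Finset.sum_range_succ, ih (by omega)]
      obtain ⟨k, rfl⟩ := Nat.exists_eq_add_of_le hm
      have hLm : L + 2 * ((m + 1 : ℕ) : ℂ) ≠ 0 := by
        have := add_natCast_ne_zero_of_poch hL (show 2 * (m + 1) < 2 * (m + 1 + k) + 2 by omega)
        simpa using this
      rw [wellPoisedTerm_eq _ _ _ _ _ _ _ hLm, add_assoc (m + 1) k 1,
        wellPoisedTerm_eq _ _ _ _ _ _ _ hLm]
      have hLk : poch L (2 * (m + 1) + k + 1 + 1) ≠ 0 := poch_ne_zero_of_le hL (by omega)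
      have hb' : poch (1 + a - b) (m + 1) ≠ 0 := poch_ne_zero_of_le hb (by omega)
      have hc' : poch (1 + a - c) (m + 1) ≠ 0 := poch_ne_zero_of_le hc (by omega)
      have hd' : poch (1 + a - d) (m + 1) ≠ 0 := poch_ne_zero_of_le hd (by omega)
      have h4 : (m : ℂ) + 1 ≠ 0 := Nat.cast_add_one_ne_zero m
      have h5 : (m.factorial : ℂ) ≠ 0 := Nat.cast_ne_zero.2 m.factorial_ne_zero
      have h6 : (k : ℂ) + 1 ≠ 0 := Nat.cast_add_one_ne_zero k
      have h7 : (k.factorial : ℂ) ≠ 0 := Nat.cast_ne_zero.2 k.factorial_ne_zero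
      have hi' := hi (m + 1)
      simp only [wellPoisedCompanion]
      rw [show m + 1 + k - m = k + 1 by omega, show m + 1 + k - (m + 1) = k by omega,
        show m + 1 + k + m + 2 = 2 * (m + 1) + k + 1 by ring,
        show m + 1 + k + (m + 1) + 2 = 2 * (m + 1) + k + 1 + 1 by ring,
        show 2 * (m + 1) + (k + 1) + 1 = 2 * (m + 1) + k + 1 + 1 by ring,
        poch_succ_left (a + ((m + 1 + k : ℕ) : ℂ)),
        show a + ((m + 1 + (k + 1) : ℕ) : ℂ) = a + ((m + 1 + k : ℕ) : ℂ) + 1 by push_cast; ring]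
      rw [poch_succ L (2 * (m + 1) + k + 1)] at hLk ⊢
      have h8 := left_ne_zero_of_mul hLk
      have h9 := right_ne_zero_of_mul hLk
      generalize poch L (2 * (m + 1) + k + 1) = W at *
      rw [poch_succ] at hb' hc' hd'
      have hb1 := left_ne_zero_of_mul hb'
      have hb2 := right_ne_zero_of_mul hb'
      have hc1 := left_ne_zero_of_mul hc'
      have hc2 := right_ne_zero_of_mul hc'
      have hd1 := left_ne_zero_of_mul hd'
      have hd2 := right_ne_zero_of_mul hd'
      simp only [poch_succ, Nat.factorial_succ]
      push_cast at hi' h9 ⊢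
      generalize R (m + 1 + 1) = R2 at *
      generalize R (m + 1) = R1 at *
      generalize w (m + 1) = w1 at *
      generalize poch (L + b - a) m = P1
      generalize poch (L + c - a) m = P2
      generalize poch (L + d - a) m = P3
      generalize poch L m = P4
      generalize poch (a - L) k = P5
      generalize poch (a + (m + 1 + k) + 1) m = P6
      generalize poch (1 + a - b) m = Q1 at *
      generalize poch (1 + a - c) m = Q2 at *
      generalize poch (1 + a - d) m = Q3 at *
      generalize (m.factorial : ℂ) = f1 at *
      generalize (k.factorial : ℂ) = f2 at *
      generalize P4 * (L + m) = A0
      generalize P1 * (L + b - a + m) = A1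
      generalize P2 * (L + c - a + m) = A2
      generalize P3 * (L + d - a + m) = A3
      clear ih hi h0 hf hL hb hc hd hLm hLk hb' hc' hd'
      generalize hx0 : L + ((m : ℂ) + 1) = x0
      generalize hx1 : L + b - a + ((m : ℂ) + 1) = x1
      generalize hx2 : L + c - a + ((m : ℂ) + 1) = x2
      generalize hx3 : L + d - a + ((m : ℂ) + 1) = x3
      generalize hx4 : a + ((m : ℂ) + 1 + k) + 1 + m = x4
      generalize hx5 : a + ((m : ℂ) + 1 + k) = x5
      generalize hx6 : a - L + (k : ℂ) = x6
      generalize hx7 : L + 2 * ((m : ℂ) + 1) = x7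
      generalize hy0 : L + (2 * ((m : ℂ) + 1) + k + 1) = y0 at *
      generalize hy1 : 1 + a - b + (m : ℂ) = y1 at *
      generalize hy2 : 1 + a - c + (m : ℂ) = y2 at *
      generalize hy3 : 1 + a - d + (m : ℂ) = y3 at *
      generalize hm1 : (m : ℂ) + 1 = m1 at *
      generalize hk1 : (k : ℂ) + 1 = k1 at *
      have hpoly : R1 * (m1 * y1 * y2 * y3 * x6 * y0) + (u * (w1 * (x4 * x6 * x7)) -
          v * (w1 * (x5 * x7 * k1 * y0))) = R2 * (x0 * x1 * x2 * x3 * x4 * k1) := by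
        subst hx0 hx1 hx2 hx3 hx4 hx5 hx6 hx7 hy0 hy1 hy2 hy3 hk1
        subst hm1
        linear_combination hi'
      clear hi' hx0 hx1 hx2 hx3 hx4 hx5 hx6 hx7 hy0 hy1 hy2 hy3 hk1 hm1
      field_simp
      linear_combination A0 * A1 * A2 * A3 * P6 * P5 * hpoly
  have hlast : u * (w (N + 1) * wellPoisedTerm a b c d L (N + 1) (N + 1)) =
      -(R (N + 1) * wellPoisedCompanion a b c d L N N) := by
    have h4 : (N : ℂ) + 1 ≠ 0 := Nat.cast_add_one_ne_zero N
    have h5 : (N.factorial : ℂ) ≠ 0 := Nat.cast_ne_zero.2 N.factorial_ne_zero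
    simp only [wellPoisedTerm, wellPoisedCompanion, Nat.sub_self, poch_zero, Nat.factorial_zero]
    rw [show N + N + 2 = 2 * N + 2 by ring, show 2 * (N + 1) = 2 * N + 2 by ring,
      show a + ((N + 1 : ℕ) : ℂ) = a + N + 1 by push_cast; ring, poch_succ (a + N + 1) N,
      poch_succ (1 + a - b) N, poch_succ (1 + a - c) N, poch_succ (1 + a - d) N,
      Nat.factorial_succ]
    rw [poch_succ] at hb hc hd
    have hb1 := left_ne_zero_of_mul hb
    have hb2 := right_ne_zero_of_mul hb
    have hc1 := left_ne_zero_of_mul hc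
    have hc2 := right_ne_zero_of_mul hc
    have hd1 := left_ne_zero_of_mul hd
    have hd2 := right_ne_zero_of_mul hd
    push_cast
    field_simp
    linear_combination poch L (N + 1) * poch (L + b - a) (N + 1) * poch (L + c - a) (N + 1) *
      poch (L + d - a) (N + 1) * poch (a + N + 1) N * hf
  have hN := key N le_rfl
  rw [Finset.sum_sub_distrib, ← Finset.mul_sum, ← Finset.mul_sum] at hN
  rw [Finset.sum_range_succ, mul_add, hlast]
  linear_combination hN

/-- The closed form of the sums of `wellPoisedTerm`. -/
noncomputable def pochQuotient (a b c d : ℂ) (N : ℕ) : ℂ :=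
  poch b N * poch c N * poch d N /
    (N.factorial * poch (1 + a - b) N * poch (1 + a - c) N * poch (1 + a - d) N)

theorem pochQuotient_succ (a b c d : ℂ) (N : ℕ) (hb : poch (1 + a - b) (N + 1) ≠ 0)
    (hc : poch (1 + a - c) (N + 1) ≠ 0) (hd : poch (1 + a - d) (N + 1) ≠ 0) :
    ((N + 1) * (1 + a - b + N) * (1 + a - c + N) * (1 + a - d + N)) *
        pochQuotient a b c d (N + 1) =
      ((b + N) * (c + N) * (d + N)) * pochQuotient a b c d N := by
  have h4 : (N : ℂ) + 1 ≠ 0 := Nat.cast_add_one_ne_zero N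
  have h5 : (N.factorial : ℂ) ≠ 0 := Nat.cast_ne_zero.2 N.factorial_ne_zero
  simp only [pochQuotient, Nat.factorial_succ]
  rw [poch_succ] at hb hc hd
  have hb1 := left_ne_zero_of_mul hb
  have hb2 := right_ne_zero_of_mul hb
  have hc1 := left_ne_zero_of_mul hc
  have hc2 := right_ne_zero_of_mul hc
  have hd1 := left_ne_zero_of_mul hd
  have hd2 := right_ne_zero_of_mul hd
  simp only [poch_succ]
  push_cast
  field_simp

/-- A sum of weighted `wellPoisedTerm`s obeying the recurrence of `pochQuotient` is a multiple
of it. -/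
theorem sum_wellPoisedTerm_of_certificate (a b c d L : ℂ) (w : ℕ → ℂ) (R : ℕ → ℕ → ℂ)
    (h0 : ∀ N : ℕ, w 0 * (((N + 1) * (1 + a - b + N) * (1 + a - c + N) * (1 + a - d + N)) *
        (a - L + N) - ((b + N) * (c + N) * (d + N)) * (N + 1) * (L + N + 1)) =
      R N 1 * (L + b - a) * (L + c - a) * (L + d - a) * (N + 1))
    (hi : ∀ N i : ℕ, w i * (L + 2 * i) *
        (((N + 1) * (1 + a - b + N) * (1 + a - c + N) * (1 + a - d + N)) *
          (a + N + i) * (a - L + N - i)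
        - ((b + N) * (c + N) * (d + N)) * (a + N) * (N + 1 - i) * (L + N + 1 + i)) =
      R N (i + 1) * (L + i) * (L + b - a + i) * (L + c - a + i) * (L + d - a + i) *
          (a + N + i) * (N + 1 - i)
        - R N i * i * (a - b + i) * (a - c + i) * (a - d + i) * (a - L + N - i) *
          (L + N + 1 + i))
    (hf : ∀ N : ℕ, w (N + 1) * (a + 2 * N + 1) = -R N (N + 1))
    (N : ℕ) (hL : poch L (2 * N) ≠ 0) (hb : poch (1 + a - b) N ≠ 0)
    (hc : poch (1 + a - c) N ≠ 0) (hd : poch (1 + a - d) N ≠ 0) :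
    ∑ m ∈ Finset.range (N + 1), w m * wellPoisedTerm a b c d L N m =
      w 0 * pochQuotient a b c d N := by
  induction N with
  | zero => simp [wellPoisedTerm, pochQuotient, poch_zero]
  | succ N ih =>
    have ih' := ih (poch_ne_zero_of_le hL (by omega)) (poch_ne_zero_of_le hb (by omega))
      (poch_ne_zero_of_le hc (by omega)) (poch_ne_zero_of_le hd (by omega))
    have hu : ((N + 1) * (1 + a - b + N) * (1 + a - c + N) * (1 + a - d + N) : ℂ) ≠ 0 := by
      have h4 : (N : ℂ) + 1 ≠ 0 := Nat.cast_add_one_ne_zero N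
      exact mul_ne_zero (mul_ne_zero (mul_ne_zero h4
        (add_natCast_ne_zero_of_poch hb N.lt_succ_self))
        (add_natCast_ne_zero_of_poch hc N.lt_succ_self))
        (add_natCast_ne_zero_of_poch hd N.lt_succ_self)
    apply mul_left_cancel₀ hu
    rw [sum_wellPoisedTerm_step a b c d L N _ _ w (R N) hL hb hc hd (h0 N) (hi N)
      (by linear_combination ((N + 1) * (1 + a - b + N) * (1 + a - c + N) * (1 + a - d + N)) *
        hf N), ih']
    linear_combination (-w 0) * pochQuotient_succ a b c d N hb hc hd

/-- Dougall's summation of the terminating two-balanced very-well-poised `₇F₆`. -/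
theorem sum_wellPoisedTerm (a b c d L : ℂ) (hL' : L = 1 + 2 * a - b - c - d)
    (N : ℕ) (hL : poch L (2 * N) ≠ 0) (hb : poch (1 + a - b) N ≠ 0)
    (hc : poch (1 + a - c) N ≠ 0) (hd : poch (1 + a - d) N ≠ 0) :
    ∑ m ∈ Finset.range (N + 1), wellPoisedTerm a b c d L N m = pochQuotient a b c d N := by
  have := sum_wellPoisedTerm_of_certificate a b c d L (fun _ => 1)
    (fun N _ => -(2 * N + 1 + a)) ?_ ?_ ?_ N hL hb hc hd
  · simpa using this
  · intro N
    subst hL'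
    ring
  · intro N i
    subst hL'
    ring
  · intro N
    ring

/-- The polynomial identity behind `sum_quadratic_mul_wellPoisedTerm`, in coordinates symmetric
under `b, c, d` and under reversal of the summation index. -/
theorem quadratic_certificate_identity (g f h t s1 s2 s3 : ℂ) (U V w : ℂ → ℂ)
    (hs1 : s1 = g - 1 - h - f)
    (hU : ∀ x, U x = x ^ 3 + s1 * x ^ 2 + s2 * x + s3)
    (hV : ∀ x, V x = x ^ 3 - s1 * x ^ 2 + s2 * x - s3)
    (hw : ∀ x, w x = U h + (h + s1) * (x ^ 2 - h ^ 2)) :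
    w t * (2 * t) * ((g - h) * V g * ((f + t) * (f - t)) -
        U f * (f + h) * ((g - t) * (g + t))) =
      (g + f) * (((g - (t + 1)) * (f + (t + 1)) - w (t + 1)) * (t + h) * U t * (f + t) * (g - t) -
        ((g - t) * (f + t) - w t) * (t - h) * V t * (f - t) * (g + t)) := by
  simp only [hw, hU, hV, hs1]
  ring

theorem sum_quadratic_mul_wellPoisedTerm (a b c d L : ℂ) (hL' : L = 2 * a - b - c - d)
    (N : ℕ) (hL : poch L (2 * N) ≠ 0) (hb : poch (1 + a - b) N ≠ 0)
    (hc : poch (1 + a - c) N ≠ 0) (hd : poch (1 + a - d) N ≠ 0) :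
    ∑ m ∈ Finset.range (N + 1),
        ((a - b - c) * (a - b - d) * (a - c - d) + (a - b - c - d) * (m * (m + L))) *
          wellPoisedTerm a b c d L N m =
      (a - b - c) * (a - b - d) * (a - c - d) * pochQuotient a b c d N := by
  have := sum_wellPoisedTerm_of_certificate a b c d L
    (fun m => (a - b - c) * (a - b - d) * (a - c - d) + (a - b - c - d) * (m * (m + L)))
    (fun N i => (2 * N + 1 + a) * ((N + 1 - i) * (N + a + i) -
      ((a - b - c) * (a - b - d) * (a - c - d) + (a - b - c - d) * (i * (i + L)))))
    ?_ ?_ ?_ N hL hb hc hd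
  · simpa using this
  · intro N
    subst hL'
    push_cast
    ring
  · intro N i
    have hroots : ∀ x e₁ e₂ e₃ : ℂ, (x + e₁) * (x + e₂) * (x + e₃) =
        x ^ 3 + (e₁ + e₂ + e₃) * x ^ 2 + (e₁ * e₂ + e₁ * e₃ + e₂ * e₃) * x + e₁ * e₂ * e₃ := by
      intros; ring
    have hL2 : a = L / 2 - (L / 2 - (a - b) + (L / 2 - (a - c)) + (L / 2 - (a - d))) := by
      rw [hL']; ring
    have := quadratic_certificate_identity (N + 1 + L / 2) (a + N - L / 2) (L / 2) (i + L / 2) _ _ _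
      (fun x => (x + (L / 2 - (a - b))) * (x + (L / 2 - (a - c))) * (x + (L / 2 - (a - d))))
      (fun x => (x - (L / 2 - (a - b))) * (x - (L / 2 - (a - c))) * (x - (L / 2 - (a - d))))
      (fun x => (a - b - c) * (a - b - d) * (a - c - d) +
        (a - b - c - d) * (x ^ 2 - (L / 2) ^ 2))
      (by linear_combination hL2) (fun x => hroots x _ _ _) (fun x => by ring)
      (fun x => by rw [hL']; ring)
    have e1 : ∀ z : ℂ, a + N - L / 2 + (L / 2 - (a - z)) = z + N := fun z => by ring
    have e2 : ∀ z : ℂ, (N : ℂ) + 1 + L / 2 - (L / 2 - (a - z)) = 1 + a - z + N := fun z => by ring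
    have e3 : ∀ z : ℂ, i + L / 2 + (L / 2 - (a - z)) = L + z - a + i := fun z => by ring
    have e4 : ∀ z : ℂ, i + L / 2 - (L / 2 - (a - z)) = a - z + i := fun z => by ring
    simp only [e1, e2, e3, e4] at this
    rw [show (i : ℂ) * (i + L) = (i + L / 2) ^ 2 - (L / 2) ^ 2 by ring,
      show ((i + 1 : ℕ) : ℂ) * ((i + 1 : ℕ) + L) = (i + L / 2 + 1) ^ 2 - (L / 2) ^ 2 by
        push_cast; ring]
    push_cast
    generalize (a - b - c) * (a - b - d) * (a - c - d) +
        (a - b - c - d) * ((i + L / 2) ^ 2 - (L / 2) ^ 2) = w1 at *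
    generalize (a - b - c) * (a - b - d) * (a - c - d) +
        (a - b - c - d) * ((i + L / 2 + 1) ^ 2 - (L / 2) ^ 2) = w2 at *
    generalize (1 + a - b + N) = y1 at *
    generalize (1 + a - c + N) = y2 at *
    generalize (1 + a - d + N) = y3 at *
    generalize (b + (N : ℂ)) = y4 at *
    generalize (c + (N : ℂ)) = y5 at *
    generalize (d + (N : ℂ)) = y6 at *
    generalize (L + b - a + (i : ℂ)) = z1 at *
    generalize (L + c - a + (i : ℂ)) = z2 at *
    generalize (L + d - a + (i : ℂ)) = z3 at *
    generalize (a - b + (i : ℂ)) = z4 at *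
    generalize (a - c + (i : ℂ)) = z5 at *
    generalize (a - d + (i : ℂ)) = z6 at *
    linear_combination this
  · intro N
    push_cast
    ring

theorem wellPoisedTerm_succ_succ (a b c d L : ℂ) (N m : ℕ) (hL0 : L ≠ 0) (hL1 : L + 1 ≠ 0) :
    ((m + 1 : ℕ) * ((m + 1 : ℕ) + L)) * wellPoisedTerm a b c d L (N + 1) (m + 1) =
      (L + b - a) * (L + c - a) * (L + d - a) * (a + N + 1) /
          ((1 + a - b) * (1 + a - c) * (1 + a - d)) *
        wellPoisedTerm (a + 2) (b + 1) (c + 1) (d + 1) (L + 2) N m := by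
  have h4 : (m : ℂ) + 1 ≠ 0 := Nat.cast_add_one_ne_zero m
  have e1 : poch L (m + 1) * (L + m + 1) = L * (L + 1) * poch (L + 2) m := by
    rw [show L + 2 = L + 1 + 1 by ring, mul_assoc, ← poch_succ_left, ← poch_succ_left,
      poch_succ _ (m + 1)]
    push_cast
    ring
  have e2 : poch L (2 * (m + 1)) = L * (L + 1) * poch (L + 2) (2 * m) := by
    rw [show L + 2 = L + 1 + 1 by ring, mul_assoc, ← poch_succ_left, ← poch_succ_left]
    rfl
  have e3 : 1 + L + 2 * ((m + 1 : ℕ) : ℂ) = 1 + (L + 2) + 2 * m := by push_cast; ring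
  rw [wellPoisedTerm, wellPoisedTerm, e2, e3, Nat.add_sub_add_right,
    poch_succ_left (L + b - a), poch_succ_left (L + c - a), poch_succ_left (L + d - a),
    poch_succ_left (1 + a - b), poch_succ_left (1 + a - c), poch_succ_left (1 + a - d),
    poch_succ_left (a + (N + 1 : ℕ)), Nat.factorial_succ,
    show a + 2 - (L + 2) = a - L by ring,
    show L + 2 + (b + 1) - (a + 2) = L + b - a + 1 by ring,
    show L + 2 + (c + 1) - (a + 2) = L + c - a + 1 by ring,
    show L + 2 + (d + 1) - (a + 2) = L + d - a + 1 by ring,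
    show 1 + (a + 2) - (b + 1) = 1 + a - b + 1 by ring,
    show 1 + (a + 2) - (c + 1) = 1 + a - c + 1 by ring,
    show 1 + (a + 2) - (d + 1) = 1 + a - d + 1 by ring,
    show a + 2 + (N : ℂ) = a + (N + 1 : ℕ) + 1 by push_cast; ring,
    div_mul_div_comm, mul_div_assoc']
  refine Eq.trans ?_ (mul_div_mul_left _ _ (mul_ne_zero h4 (mul_ne_zero hL0 hL1)))
  congr 1
  · push_cast
    linear_combination (m + 1) * (L + b - a) * poch (L + b - a + 1) m * ((L + c - a) *
      poch (L + c - a + 1) m) * ((L + d - a) * poch (L + d - a + 1) m) * ((a + (N + 1)) *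
      poch (a + (N + 1) + 1) m) * poch (a - L) (N - m) * e1
  · push_cast
    ring

theorem sum_index_mul_wellPoisedTerm (a b c d L : ℂ) (hL' : L = 2 * a - b - c - d)
    (N : ℕ) (hL : poch L (2 * N) ≠ 0) (hb : poch (1 + a - b) N ≠ 0)
    (hc : poch (1 + a - c) N ≠ 0) (hd : poch (1 + a - d) N ≠ 0) :
    b * c * d * ∑ m ∈ Finset.range (N + 1), (m * (m + L)) * wellPoisedTerm a b c d L N m =
      (a - b - c) * (a - b - d) * (a - c - d) * (N * (N + a)) * pochQuotient a b c d N := by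
  cases N with
  | zero => simp
  | succ N =>
    have hL0 : L ≠ 0 := by
      simpa using add_natCast_ne_zero_of_poch hL (show 0 < 2 * (N + 1) by omega)
    have hL1 : L + 1 ≠ 0 := by
      simpa using add_natCast_ne_zero_of_poch hL (show 1 < 2 * (N + 1) by omega)
    have hL2 : poch (L + 2) (2 * N) ≠ 0 := by
      rw [show 2 * (N + 1) = 2 * N + 1 + 1 by ring, poch_succ_left, poch_succ_left,
        show L + 1 + 1 = L + 2 by ring] at hL
      exact right_ne_zero_of_mul (right_ne_zero_of_mul hL)
    rw [poch_succ_left] at hb hc hd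
    have hb1 := left_ne_zero_of_mul hb
    have hb2 := right_ne_zero_of_mul hb
    have hc1 := left_ne_zero_of_mul hc
    have hc2 := right_ne_zero_of_mul hc
    have hd1 := left_ne_zero_of_mul hd
    have hd2 := right_ne_zero_of_mul hd
    rw [Finset.sum_range_succ']
    simp only [wellPoisedTerm_succ_succ a b c d L N _ hL0 hL1]
    rw [← Finset.mul_sum, sum_wellPoisedTerm _ _ _ _ _ (by rw [hL']; ring) _ hL2
      (by convert hb2 using 2; ring) (by convert hc2 using 2; ring) (by convert hd2 using 2; ring)]
    have h4 : (N : ℂ) + 1 ≠ 0 := Nat.cast_add_one_ne_zero N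
    have h5 : (N.factorial : ℂ) ≠ 0 := Nat.cast_ne_zero.2 N.factorial_ne_zero
    simp only [pochQuotient, poch_succ_left, Nat.factorial_succ]
    rw [show L + b - a = a - c - d by rw [hL']; ring, show L + c - a = a - b - d by rw [hL']; ring,
      show L + d - a = a - b - c by rw [hL']; ring, show 1 + (a + 2) - (b + 1) = 1 + a - b + 1 by ring,
      show 1 + (a + 2) - (c + 1) = 1 + a - c + 1 by ring,
      show 1 + (a + 2) - (d + 1) = 1 + a - d + 1 by ring]
    push_cast
    generalize poch (1 + a - b + 1) N = Q1 at *
    generalize poch (1 + a - c + 1) N = Q2 at *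
    generalize poch (1 + a - d + 1) N = Q3 at *
    generalize 1 + a - b = y1 at *
    generalize 1 + a - c = y2 at *
    generalize 1 + a - d = y3 at *
    generalize a - c - d = x1
    generalize a - b - d = x2
    generalize a - b - c = x3
    field_simp
    ring

/-- The summation that matches the coefficients of `x ^ N`. -/
theorem sum_mul_wellPoisedTerm (a b c d q L : ℂ) (hL' : L = 2 * a - b - c - d)
    (N : ℕ) (hL : poch L (2 * N) ≠ 0) (hb : poch (1 + a - b) N ≠ 0)
    (hc : poch (1 + a - c) N ≠ 0) (hd : poch (1 + a - d) N ≠ 0) :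
    ∑ m ∈ Finset.range (N + 1),
        (q * ((a - b - c) * (a - b - d) * (a - c - d)) +
          (b * c * d + q * (a - b - c - d)) * (m * (m + L))) * wellPoisedTerm a b c d L N m =
      (a - b - c) * (a - b - d) * (a - c - d) * (q + N * (N + a)) * pochQuotient a b c d N := by
  have h1 := sum_index_mul_wellPoisedTerm a b c d L hL' N hL hb hc hd
  have h2 := sum_quadratic_mul_wellPoisedTerm a b c d L hL' N hL hb hc hd
  rw [show (a - b - c) * (a - b - d) * (a - c - d) * (q + N * (N + a)) *
      pochQuotient a b c d N = q * ((a - b - c) * (a - b - d) * (a - c - d) *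
      pochQuotient a b c d N) + (a - b - c) * (a - b - d) * (a - c - d) * (N * (N + a)) *
      pochQuotient a b c d N by ring, ← h1, ← h2,
    Finset.mul_sum, Finset.mul_sum, ← Finset.sum_add_distrib]
  refine Finset.sum_congr rfl fun m _ => ?_
  ring

theorem poch_add_one_mul_poch_add_one (L γ : ℂ) (m : ℕ) :
    (L ^ 2 / 4 - γ ^ 2) * (poch (L / 2 - γ + 1) m * poch (L / 2 + γ + 1) m) =
      poch (L / 2 + γ) m * poch (L / 2 - γ) m * (L ^ 2 / 4 - γ ^ 2 + m * (m + L)) := by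
  have h1 := poch_add_one_eq (L / 2 - γ) m
  have h2 := poch_add_one_eq (L / 2 + γ) m
  linear_combination (L / 2 + γ) * poch (L / 2 + γ + 1) m * h1 +
    poch (L / 2 - γ) m * (L / 2 - γ + m) * h2

theorem expansion_coefficient_term (a b c d L γ D E : ℂ) (m k : ℕ) (hD : D ≠ 0) (hE : E ≠ 0)
    (hγ : γ ^ 2 = L ^ 2 / 4 - E / D) (hb : poch (1 + a - b) m ≠ 0) (hc : poch (1 + a - c) m ≠ 0)
    (hd : poch (1 + a - d) m ≠ 0) (hL1 : poch (L / 2) m ≠ 0) (hL2 : poch ((L + 1) / 2) m ≠ 0)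
    (hγ1 : poch (L / 2 + γ) m ≠ 0) (hγ2 : poch (L / 2 - γ) m ≠ 0)
    (hW : poch (1 + L + 2 * m) k ≠ 0) :
    (poch L m * poch (L + b - a) m * poch (L + c - a) m * poch (L + d - a) m *
          poch (a / 2) m * poch ((a + 1) / 2) m * poch (L / 2 - γ + 1) m *
          poch (L / 2 + γ + 1) m) /
        (m.factorial * poch (L / 2) m * poch ((L + 1) / 2) m * poch (1 + a - b) m *
          poch (1 + a - c) m * poch (1 + a - d) m * poch (L / 2 + γ) m * poch (L / 2 - γ) m) *
      (poch (a + 2 * m) k * poch (a - L) k / (k.factorial * poch (1 + L + 2 * m) k)) =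
    poch a (m + k) / E * ((E + D * (m * (m + L))) * wellPoisedTerm a b c d L (m + k) m) := by
  have hA : 4 ^ m * (poch (a / 2) m * poch ((a + 1) / 2) m) * poch (a + 2 * m) k =
      poch a (m + k) * poch (a + (m + k : ℕ)) m := by
    rw [← poch_two_mul, ← poch_add, show m + k + m = 2 * m + k by ring, poch_add]
    push_cast
    rfl
  have hg : E * (poch (L / 2 - γ + 1) m * poch (L / 2 + γ + 1) m) =
      poch (L / 2 + γ) m * poch (L / 2 - γ) m * (E + D * (m * (m + L))) := by
    have h := poch_add_one_mul_poch_add_one L γ m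
    have hED : E / D * D = E := div_mul_cancel₀ E hD
    rw [show L ^ 2 / 4 - γ ^ 2 = E / D by rw [hγ]; ring] at h
    generalize E / D = G at *
    linear_combination D * h - (poch (L / 2 - γ + 1) m * poch (L / 2 + γ + 1) m -
      poch (L / 2 + γ) m * poch (L / 2 - γ) m) * hED
  have h5 : (m.factorial : ℂ) ≠ 0 := Nat.cast_ne_zero.2 m.factorial_ne_zero
  have h6 : (k.factorial : ℂ) ≠ 0 := Nat.cast_ne_zero.2 k.factorial_ne_zero
  have h7 : (4 : ℂ) ^ m ≠ 0 := pow_ne_zero m (by norm_num)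
  rw [wellPoisedTerm, Nat.add_sub_cancel_left, poch_two_mul L]
  generalize poch (a / 2) m = A1 at *
  generalize poch ((a + 1) / 2) m = A2 at *
  generalize poch (a + 2 * m) k = A3 at *
  generalize poch a (m + k) = A4 at *
  generalize poch (a + (m + k : ℕ)) m = A5 at *
  generalize poch (L / 2 - γ + 1) m = g1 at *
  generalize poch (L / 2 + γ + 1) m = g2 at *
  generalize poch (L / 2 + γ) m = g3 at *
  generalize poch (L / 2 - γ) m = g4 at *
  generalize E + D * (m * (m + L)) = w at *
  generalize poch L m = P0
  generalize poch (L + b - a) m = P1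
  generalize poch (L + c - a) m = P2
  generalize poch (L + d - a) m = P3
  generalize poch (1 + a - b) m = Q1 at *
  generalize poch (1 + a - c) m = Q2 at *
  generalize poch (1 + a - d) m = Q3 at *
  generalize poch (L / 2) m = L1 at *
  generalize poch ((L + 1) / 2) m = L2 at *
  generalize poch (1 + L + 2 * m) k = W at *
  generalize poch (a - L) k = F at *
  generalize (m.factorial : ℂ) = f1 at *
  generalize (k.factorial : ℂ) = f2 at *
  generalize (4 : ℂ) ^ m = f4 at *
  clear hγ
  field_simp
  linear_combination F * P0 * P1 * P2 * P3 * (E * g1 * g2 * hA + A4 * A5 * hg)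

theorem expansion_coefficient (a b c d p L γ : ℂ) (hL : L = 2 * a - b - c - d)
    (hbcd : b * c * d + p * (a - p) * (a - b - c - d) ≠ 0)
    (hγ : γ ^ 2 = L ^ 2 / 4 - p * (a - p) * (a - b - c) * (a - b - d) * (a - c - d) /
        (b * c * d + p * (a - p) * (a - b - c - d))) (N : ℕ)
    (hb : poch (1 + a - b) N ≠ 0) (hc : poch (1 + a - c) N ≠ 0)
    (hd : poch (1 + a - d) N ≠ 0) (hp : poch p N ≠ 0) (hap : poch (a - p) N ≠ 0)
    (hL1 : poch (L / 2) N ≠ 0) (hL2 : poch ((L + 1) / 2) N ≠ 0)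
    (hγ1 : poch (L / 2 + γ) N ≠ 0) (hγ2 : poch (L / 2 - γ) N ≠ 0)
    (hW : ∀ m k : ℕ, m + k = N → poch (1 + L + 2 * (m : ℂ)) k ≠ 0) :
    poch a N * poch b N * poch c N * poch d N * poch (a - p + 1) N * poch (p + 1) N /
        (N.factorial * (poch (1 + a - b) N * poch (1 + a - c) N * poch (1 + a - d) N *
          poch p N * poch (a - p) N)) =
      ∑ m ∈ Finset.range (N + 1),
        (poch L m * poch (L + b - a) m * poch (L + c - a) m * poch (L + d - a) m *
            poch (a / 2) m * poch ((a + 1) / 2) m * poch (L / 2 - γ + 1) m *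
            poch (L / 2 + γ + 1) m) /
          (m.factorial * poch (L / 2) m * poch ((L + 1) / 2) m * poch (1 + a - b) m *
            poch (1 + a - c) m * poch (1 + a - d) m * poch (L / 2 + γ) m *
            poch (L / 2 - γ) m) *
        (poch (a + 2 * m) (N - m) * poch (a - L) (N - m) /
          ((N - m).factorial * poch (1 + L + 2 * m) (N - m))) := by
  rcases Nat.eq_zero_or_pos N with rfl | hN
  · simp [poch_zero]
  have hne : ∀ {z : ℂ}, poch z N ≠ 0 → z ≠ 0 := fun h => by
    simpa using add_natCast_ne_zero_of_poch h hN
  have hp0 := hne hp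
  have hap0 := hne hap
  set X := (a - b - c) * (a - b - d) * (a - c - d) with hX
  set D := b * c * d + p * (a - p) * (a - b - c - d) with hDdef
  have hγ' : γ ^ 2 = L ^ 2 / 4 - p * (a - p) * X / D := by
    rw [hγ, hX]
    ring
  have hE : p * (a - p) * X ≠ 0 := by
    intro h
    have h' := mul_ne_zero (hne hγ1) (hne hγ2)
    rw [h, zero_div] at hγ'
    exact h' (by linear_combination -hγ')
  have hX0 : X ≠ 0 := right_ne_zero_of_mul hE
  have hLN : poch L (2 * N) ≠ 0 := by
    rw [poch_two_mul]
    exact mul_ne_zero (pow_ne_zero N (by norm_num)) (mul_ne_zero hL1 hL2)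
  have hsum := sum_mul_wellPoisedTerm a b c d (p * (a - p)) L hL N hLN hb hc hd
  rw [← hX, ← hDdef] at hsum
  trans poch a N / (p * (a - p) * X) *
    (X * (p * (a - p) + N * (N + a)) * pochQuotient a b c d N)
  · have h1 := poch_add_one_eq p N
    have h2 := poch_add_one_eq (a - p) N
    have h5 : (N.factorial : ℂ) ≠ 0 := Nat.cast_ne_zero.2 N.factorial_ne_zero
    rw [pochQuotient, show p * (a - p) + N * (N + a) = (p + N) * (a - p + N) by ring]
    generalize poch (a - p + 1) N = S1 at *
    generalize poch (p + 1) N = S2 at *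
    generalize poch (1 + a - b) N = Q1 at *
    generalize poch (1 + a - c) N = Q2 at *
    generalize poch (1 + a - d) N = Q3 at *
    generalize poch p N = S3 at *
    generalize poch (a - p) N = S4 at *
    clear_value X
    generalize hap1 : a - p + (N : ℂ) = T1 at *
    generalize a - p = q at *
    field_simp
    linear_combination poch a N * poch b N * poch c N * poch d N *
      (q * S1 * h1 + S3 * (p + N) * h2)
  · rw [← hsum, Finset.mul_sum]
    refine Finset.sum_congr rfl fun m hm => ?_
    obtain ⟨k, rfl⟩ := Nat.exists_eq_add_of_le (Nat.lt_succ_iff.1 (Finset.mem_range.1 hm))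
    have hle : ∀ {z : ℂ}, poch z (m + k) ≠ 0 → poch z m ≠ 0 := fun h =>
      poch_ne_zero_of_le h (Nat.le_add_right m k)
    rw [Nat.add_sub_cancel_left]
    exact (expansion_coefficient_term a b c d L γ D _ m k hbcd hE hγ' (hle hb) (hle hc) (hle hd)
      (hle hL1) (hle hL2) (hle hγ1) (hle hγ2) (hW m k rfl)).symm

theorem proposition_13P1 (n r s : ℕ) (a b c d p x : ℂ) (A : Fin r → ℂ) (B : Fin s → ℂ)
    (lm : ℂ) (hlm : lm = 2 * a - b - c - d)
    (hbcd : b * c * d + p * (a - p) * (a - b - c - d) ≠ 0) (γ : ℂ)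
    (hγ : γ ^ 2 = lm ^ 2 / 4 -
      p * (a - p) * (a - b - c) * (a - b - d) * (a - c - d) /
        (b * c * d + p * (a - p) * (a - b - c - d)))
    (hnd : ∀ z ∈ [1 + a - b, 1 + a - c, 1 + a - d, p, a - p,
        lm / 2, (lm + 1) / 2, lm / 2 + γ, lm / 2 - γ],
      ∀ k ≤ n, poch z k ≠ 0)
    (hlam : ∀ m k : ℕ, m + k ≤ n → poch (1 + lm + 2 * (m : ℂ)) k ≠ 0)
    (hB : ∀ i : Fin s, ∀ m k : ℕ, m + k ≤ n → poch (B i + (m : ℂ)) k ≠ 0) :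
    hypTerm ([a, b, c, d, a - p + 1, p + 1] ++ List.ofFn A)
        ([1 + a - b, 1 + a - c, 1 + a - d, p, a - p] ++ List.ofFn B) n x
      = ∑ m ∈ Finset.range (n + 1),
          (poch lm m * poch (lm + b - a) m * poch (lm + c - a) m * poch (lm + d - a) m *
              poch (a / 2) m * poch ((a + 1) / 2) m *
              poch (lm / 2 - γ + 1) m * poch (lm / 2 + γ + 1) m *
              (List.ofFn fun i => poch (A i) m).prod * poch (-(n : ℂ)) m * x ^ m) /
            ((m.factorial : ℂ) * poch (lm / 2) m * poch ((lm + 1) / 2) m *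
              poch (1 + a - b) m * poch (1 + a - c) m * poch (1 + a - d) m *
              poch (lm / 2 + γ) m * poch (lm / 2 - γ) m *
              (List.ofFn fun i => poch (B i) m).prod) *
          hypTerm ([a + 2 * (m : ℂ), a - lm] ++ List.ofFn (fun i => A i + (m : ℂ)))
            ((1 + lm + 2 * (m : ℂ)) :: List.ofFn (fun i => B i + (m : ℂ))) (n - m) x := by
  set T : ℕ → ℂ := fun k => (∏ i, poch (A i) k) * poch (-(n : ℂ)) k / (∏ i, poch (B i) k) * x ^ k
    with hT
  set F : ℕ → ℕ → ℂ := fun m k => T (m + k) *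
    ((poch lm m * poch (lm + b - a) m * poch (lm + c - a) m * poch (lm + d - a) m *
        poch (a / 2) m * poch ((a + 1) / 2) m * poch (lm / 2 - γ + 1) m *
        poch (lm / 2 + γ + 1) m) /
      (m.factorial * poch (lm / 2) m * poch ((lm + 1) / 2) m * poch (1 + a - b) m *
        poch (1 + a - c) m * poch (1 + a - d) m * poch (lm / 2 + γ) m * poch (lm / 2 - γ) m) *
      (poch (a + 2 * m) k * poch (a - lm) k / (k.factorial * poch (1 + lm + 2 * m) k))) with hF
  trans ∑ N ∈ Finset.range (n + 1), ∑ m ∈ Finset.range (N + 1), F m (N - m)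
  · refine Finset.sum_congr rfl fun N hN => ?_
    have hNn : N ≤ n := Nat.lt_succ_iff.1 (Finset.mem_range.1 hN)
    simp only [List.forall_mem_cons] at hnd
    obtain ⟨hb, hc, hd, hp, hap, hL1, hL2, hγ1, hγ2, -⟩ := hnd
    trans T N * (poch a N * poch b N * poch c N * poch d N * poch (a - p + 1) N *
      poch (p + 1) N / (N.factorial * (poch (1 + a - b) N * poch (1 + a - c) N *
        poch (1 + a - d) N * poch p N * poch (a - p) N)))
    · simp only [List.map_append, List.prod_append, List.map_cons, List.map_nil, List.prod_cons,
        List.prod_nil, List.map_ofFn, List.prod_ofFn, Function.comp_apply, hT]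
      ring
    · rw [expansion_coefficient a b c d p lm γ hlm hbcd hγ N (hb N hNn) (hc N hNn) (hd N hNn)
        (hp N hNn) (hap N hNn) (hL1 N hNn) (hL2 N hNn) (hγ1 N hNn) (hγ2 N hNn)
        (fun m k h => hlam m k (h.trans_le hNn)), Finset.mul_sum]
      refine Finset.sum_congr rfl fun m hm => ?_
      rw [hF]
      simp only [Nat.add_sub_cancel' (Nat.lt_succ_iff.1 (Finset.mem_range.1 hm))]
  · rw [Finset.sum_range_diag_flip]
    refine Finset.sum_congr rfl fun m hm => ?_
    have hmn : m ≤ n := Nat.lt_succ_iff.1 (Finset.mem_range.1 hm)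
    rw [hypTerm, Finset.mul_sum, Nat.succ_sub hmn]
    refine Finset.sum_congr rfl fun k _ => ?_
    simp only [hF, hT, List.map_append, List.prod_append, List.map_cons, List.map_nil,
      List.prod_cons, List.prod_nil, List.map_ofFn, List.prod_ofFn, Function.comp_apply,
      poch_add, Finset.prod_mul_distrib, pow_add]
    rw [show -((n - m : ℕ) : ℂ) = -(n : ℂ) + m by rw [Nat.cast_sub hmn]; ring]
    ring
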